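/- arXiv:2406.09255 — 2 statements merged into one kernel-verified Lean document; each statement's English description precedes it below -/
import Mathlib

section
/- If the table satisfies the order property, then it contains no duplicate entries: for every key k there is at most one pair (x,y) ∈ S such that the (x,y)-slot of k contains k. -/
/-- The set `S` of slot positions: `(0, y)` with `y < B0` are the slots of the
primary bucket, and `(1, y)`, `(2, y)` with `y < B1` the slots of the two
secondary buckets. -/
def IceS (B0 B1 : ℕ) : Set (ℕ × ℕ) :=
  {p | (p.1 = 0 ∧ p.2 < B0) ∨ ((p.1 = 1 ∨ p.1 = 2) ∧ p.2 < B1)}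

/-- The strict order `≺` on slot positions:
`(0, x) ≺ (1 + y, z)` for all `x, y, z`;
`(x, y) ≺ (x, z)` iff `y < z`;
`(1, x) ≺ (2, y)` iff `x < y` (and hence `(2, x) ≺ (1, y)` iff `x ≤ y`). -/
def SlotPrec (p q : ℕ × ℕ) : Prop :=
  (p.1 = 0 ∧ q.1 ≠ 0) ∨
  (p.1 = q.1 ∧ p.2 < q.2) ∨
  (p.1 = 1 ∧ q.1 = 2 ∧ p.2 < q.2) ∨
  (p.1 = 2 ∧ q.1 = 1 ∧ p.2 ≤ q.2)

section IcebergTable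

variable {A0 A1 R0 R1 K : Type*} {B0 B1 : ℕ}

/-- The value of the `(x, y)`-slot of key `k`: for `x = 0` it is the `y`-th slot
of the primary bucket `T0 (a0 k)`, and for `x = 1, 2` it is the `y`-th slot of
the secondary buckets `T1 (a1 k)`, `T1 (a2 k)` respectively (level-0 and level-1
contents are distinguished by summing the content types). -/
def slotVal (T0 : A0 → Fin B0 → Option R0) (T1 : A1 → Fin B1 → Option R1)
    (a0 : K → A0) (a1 a2 : K → A1) (k : K) (p : ℕ × ℕ) : Option (R0 ⊕ R1) :=
  if h : p.1 = 0 ∧ p.2 < B0 then (T0 (a0 k) ⟨p.2, h.2⟩).map Sum.inl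
  else if h : p.1 = 1 ∧ p.2 < B1 then (T1 (a1 k) ⟨p.2, h.2⟩).map Sum.inr
  else if h : p.1 = 2 ∧ p.2 < B1 then (T1 (a2 k) ⟨p.2, h.2⟩).map Sum.inr
  else none

/-- The value whose presence in an `(x, ·)`-slot of `k` signals that the slot
contains `k`: `r0' k` for the primary bucket, `r1' k` and `r2' k` for the two
secondary buckets. -/
def keyVal (r0' : K → R0) (r1' r2' : K → R1) (k : K) (x : ℕ) : R0 ⊕ R1 :=
  if x = 0 then Sum.inl (r0' k) else if x = 1 then Sum.inr (r1' k) else Sum.inr (r2' k)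

/-- The `(x, y)`-slot of `k` contains `k`. -/
def SlotContains (T0 : A0 → Fin B0 → Option R0) (T1 : A1 → Fin B1 → Option R1)
    (a0 : K → A0) (a1 a2 : K → A1) (r0' : K → R0) (r1' r2' : K → R1)
    (k : K) (p : ℕ × ℕ) : Prop :=
  slotVal T0 T1 a0 a1 a2 k p = some (keyVal r0' r1' r2' k p.1)

/-- The order property: if a slot of `k` contains `k`, then all `≺`-earlier
slots of `k` are nonempty and do not contain `k`. -/
def OrderProp (T0 : A0 → Fin B0 → Option R0) (T1 : A1 → Fin B1 → Option R1)
    (a0 : K → A0) (a1 a2 : K → A1) (r0' : K → R0) (r1' r2' : K → R1) : Prop :=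
  ∀ k : K, ∀ p ∈ IceS B0 B1,
    SlotContains T0 T1 a0 a1 a2 r0' r1' r2' k p →
    ∀ q ∈ IceS B0 B1, SlotPrec q p →
      slotVal T0 T1 a0 a1 a2 k q ≠ none ∧
      ¬ SlotContains T0 T1 a0 a1 a2 r0' r1' r2' k q

end IcebergTable

/-- Any two distinct slot positions in `S` are comparable for `≺`. -/
theorem SlotPrec.trichotomy {B0 B1 : ℕ} {p q : ℕ × ℕ} (hp : p ∈ IceS B0 B1)
    (hq : q ∈ IceS B0 B1) : SlotPrec p q ∨ p = q ∨ SlotPrec q p := by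
  simp only [IceS, Set.mem_ofPred_eq] at hp hq
  simp only [SlotPrec, Prod.ext_iff]
  omega


/-- If the table satisfies the order property, it contains no duplicate entries:
for every key `k`, at most one slot position in `S` contains `k`. -/
theorem orderProp_no_duplicates {A0 A1 R0 R1 K : Type*} {B0 B1 : ℕ}
    (hB0 : 0 < B0) (hB1 : 0 < B1)
    (T0 : A0 → Fin B0 → Option R0) (T1 : A1 → Fin B1 → Option R1)
    (a0 : K → A0) (a1 a2 : K → A1) (r0' : K → R0) (r1' r2' : K → R1)
    (hord : OrderProp T0 T1 a0 a1 a2 r0' r1' r2') :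
    ∀ k : K, ∀ p ∈ IceS B0 B1, ∀ q ∈ IceS B0 B1,
      SlotContains T0 T1 a0 a1 a2 r0' r1' r2' k p →
      SlotContains T0 T1 a0 a1 a2 r0' r1' r2' k q →
      p = q := by
  intro k p hp q hq hkp hkq
  rcases SlotPrec.trichotomy hp hq with hpq | hpq | hqp
  · exact absurd hkp (hord k q hq hkq p hp hpq).2
  · exact hpq
  · exact absurd hkq (hord k p hp hkp q hq hqp).2
end

section
/- Insertion into the least empty slot preserves well-formedness: suppose the table (T0, T1) is well-formed, k is a key, and (x,y) ∈ S is such that the (x,y)-slot of k is empty and for every (x',y') ∈ S with (x',y') ≺ (x,y) the (x',y')-slot of k is nonempty and does not contain k. Let (T0', T1') be the table obtained from (T0, T1) by writing some (r_x' k) into the (x,y)-slot of k (i.e., updating T0 at (a0 k, y) if x = 0 and T1 at (a_x k, y) if x ∈ {1,2}) and leaving all other slots unchanged. Then (T0', T1') is well-formed. -/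
section IcebergTable

variable {A0 A1 R0 R1 K : Type*} {B0 B1 : ℕ}

/-- Well-formedness: the order property holds, every nonempty level-0 slot
`T0 a y` equals `some (r0' k')` for some key `k'` with `a0 k' = a`, and every
nonempty level-1 slot `T1 a y` equals `some (r1' k')` for some key `k'` with
`a1 k' = a` or `some (r2' k')` for some key `k'` with `a2 k' = a`. -/
def WellFormed (T0 : A0 → Fin B0 → Option R0) (T1 : A1 → Fin B1 → Option R1)
    (a0 : K → A0) (a1 a2 : K → A1) (r0' : K → R0) (r1' r2' : K → R1) : Prop :=
  OrderProp T0 T1 a0 a1 a2 r0' r1' r2' ∧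
  (∀ a y, T0 a y ≠ none → ∃ k' : K, a0 k' = a ∧ T0 a y = some (r0' k')) ∧
  (∀ a y, T1 a y ≠ none →
    (∃ k' : K, a1 k' = a ∧ T1 a y = some (r1' k')) ∨
    (∃ k' : K, a2 k' = a ∧ T1 a y = some (r2' k')))

end IcebergTable

open Classical in
/-- Insertion into the least empty slot preserves well-formedness: if the table
is well-formed, the `(x, y)`-slot of `k` is empty, and all `≺`-earlier slots of
`k` are nonempty and do not contain `k`, then the table obtained by writing
`some (r_x' k)` into the `(x, y)`-slot of `k` (leaving all other slots
unchanged) is again well-formed. -/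
theorem insert_least_empty_slot_preserves_wellFormed
    {A0 A1 R0 R1 K : Type*} {B0 B1 : ℕ} (hB0 : 0 < B0) (hB1 : 0 < B1)
    (T0 : A0 → Fin B0 → Option R0) (T1 : A1 → Fin B1 → Option R1)
    (a0 : K → A0) (a1 a2 : K → A1) (r0' : K → R0) (r1' r2' : K → R1)
    (hinj0 : Function.Injective fun k : K => (a0 k, r0' k))
    (hinj1 : Function.Injective fun k : K => (a1 k, r1' k))
    (hinj2 : Function.Injective fun k : K => (a2 k, r2' k))
    (htag : ∀ k k' : K, r1' k ≠ r2' k')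
    (hwf : WellFormed T0 T1 a0 a1 a2 r0' r1' r2')
    (k : K) (x y : ℕ) (hS : (x, y) ∈ IceS B0 B1)
    (hempty : slotVal T0 T1 a0 a1 a2 k (x, y) = none)
    (hprev : ∀ q ∈ IceS B0 B1, SlotPrec q (x, y) →
      slotVal T0 T1 a0 a1 a2 k q ≠ none ∧
      ¬ SlotContains T0 T1 a0 a1 a2 r0' r1' r2' k q)
    (T0' : A0 → Fin B0 → Option R0) (T1' : A1 → Fin B1 → Option R1)
    (hT0' : ∀ a i, T0' a i =
      if x = 0 ∧ a = a0 k ∧ (i : ℕ) = y then some (r0' k) else T0 a i)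
    (hT1' : ∀ a i, T1' a i =
      if x = 1 ∧ a = a1 k ∧ (i : ℕ) = y then some (r1' k)
      else if x = 2 ∧ a = a2 k ∧ (i : ℕ) = y then some (r2' k)
      else T1 a i) :
    WellFormed T0' T1' a0 a1 a2 r0' r1' r2' := by
  obtain ⟨hord, hw0, hw1⟩ := hwf
  have empty0 : ∀ i : Fin B0, x = 0 → (i : ℕ) = y → T0 (a0 k) i = none := by
    rintro i rfl rfl
    simpa [slotVal] using hempty
  have empty1 : ∀ i : Fin B1, x = 1 → (i : ℕ) = y → T1 (a1 k) i = none := by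
    rintro i rfl rfl
    simpa [slotVal] using hempty
  have empty2 : ∀ i : Fin B1, x = 2 → (i : ℕ) = y → T1 (a2 k) i = none := by
    rintro i rfl rfl
    simpa [slotVal] using hempty
  have inj0 : ∀ k', a0 k' = a0 k → r0' k = r0' k' → k' = k :=
    fun k' h h' => hinj0 (Prod.ext h h'.symm)
  have inj1 : ∀ k', a1 k' = a1 k → r1' k = r1' k' → k' = k :=
    fun k' h h' => hinj1 (Prod.ext h h'.symm)
  have inj2 : ∀ k', a2 k' = a2 k → r2' k = r2' k' → k' = k :=
    fun k' h h' => hinj2 (Prod.ext h h'.symm)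
  have unchanged_or_new : ∀ k' p,
      slotVal T0' T1' a0 a1 a2 k' p = slotVal T0 T1 a0 a1 a2 k' p ∨
      (slotVal T0 T1 a0 a1 a2 k' p = none ∧
        (SlotContains T0' T1' a0 a1 a2 r0' r1' r2' k' p → k' = k ∧ p = (x, y))) := by
    rintro k' ⟨u, v⟩
    simp only [SlotContains, slotVal, keyVal, hT0', hT1']
    grind
  refine ⟨?_, ?_, ?_⟩
  · intro k' p hp hc q hq hqp
    have old : slotVal T0 T1 a0 a1 a2 k' q ≠ none ∧
        ¬ SlotContains T0 T1 a0 a1 a2 r0' r1' r2' k' q := by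
      rcases unchanged_or_new k' p with h | ⟨-, h⟩
      · exact hord k' p hp (h.symm.trans hc) q hq hqp
      · obtain ⟨rfl, rfl⟩ := h hc
        exact hprev q hq hqp
    have hval := (unchanged_or_new k' q).resolve_right fun h => old.1 h.1
    simpa only [SlotContains, hval] using old
  · intro a i h
    rw [hT0'] at h ⊢
    split_ifs at h ⊢ with hc
    · exact ⟨k, hc.2.1.symm, rfl⟩
    · exact hw0 a i h
  · intro a i h
    rw [hT1'] at h ⊢
    split_ifs at h ⊢ with hc hc'
    · exact .inl ⟨k, hc.2.1.symm, rfl⟩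
    · exact .inr ⟨k, hc'.2.1.symm, rfl⟩
    · exact hw1 a i h
end
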